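/- Let n ≥ 1, let G be any n-dimensional hypercube-like network (G ∈ HL_n), and let g be an integer with 1 ≤ g ≤ 2^n. Write g in binary as g = Σ_{i=0}^s 2^{t_i} with t_0 > t_1 > ... > t_s ≥ 0. Then the maximum, over all vertex subsets X of G with |X| = g, of the number of edges of the subgraph of G induced by X equals e_g = Σ_{i=0}^s t_i·2^{t_i−1} + Σ_{i=0}^s i·2^{t_i} (equivalently, twice this maximum equals Σ_{i=0}^s (t_i + 2i)·2^{t_i}). -/

import Mathlib

/-- `IsHL n G` : `G` is an `n`-dimensional hypercube-like network (`G ∈ HL_n`).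
`HL_0 = {K_1}`, and `G ∈ HL_n` iff the vertex set can be partitioned into `S` and `Sᶜ`
with both induced subgraphs in `HL_{n-1}` and the edges between `S` and `Sᶜ`
forming a perfect matching between them. -/
def IsHL : (n : ℕ) → {V : Type} → [Fintype V] → [DecidableEq V] → SimpleGraph V → Prop
  | 0, V, _, _, _ => Fintype.card V = 1
  | n + 1, _, _, _, G =>
      ∃ S : Finset _,
        IsHL n (G.induce (S : Set _)) ∧
        IsHL n (G.induce ((Sᶜ : Finset _) : Set _)) ∧
        (∀ v ∈ S, ∃! w, w ∉ S ∧ G.Adj v w) ∧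
        (∀ v ∉ S, ∃! w, w ∈ S ∧ G.Adj v w)

/-- The number of binary ones of all natural numbers below `g`; this is the maximal number of
edges induced by `g` vertices of a hypercube-like network. -/
def binaryOnesBelow (g : ℕ) : ℕ := ∑ k ∈ Finset.range g, (Nat.digits 2 k).sum

theorem digits_two_sum_two_mul (m : ℕ) :
    (Nat.digits 2 (2 * m)).sum = (Nat.digits 2 m).sum := by
  rcases Nat.eq_zero_or_pos m with rfl | h
  · simp
  · rw [Nat.digits_def' (by norm_num) (by omega)]
    simp

theorem digits_two_sum_two_mul_add_one (m : ℕ) :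
    (Nat.digits 2 (2 * m + 1)).sum = (Nat.digits 2 m).sum + 1 := by
  rw [Nat.digits_def' (by norm_num) (by omega), show (2 * m + 1) % 2 = 1 by omega,
    show (2 * m + 1) / 2 = m by omega, List.sum_cons, add_comm]

theorem binaryOnesBelow_succ (g : ℕ) :
    binaryOnesBelow (g + 1) = binaryOnesBelow g + (Nat.digits 2 g).sum :=
  Finset.sum_range_succ _ _

@[simp] theorem binaryOnesBelow_zero : binaryOnesBelow 0 = 0 := rfl

@[simp] theorem binaryOnesBelow_one : binaryOnesBelow 1 = 0 := by simp [binaryOnesBelow]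

theorem binaryOnesBelow_two_mul (m : ℕ) :
    binaryOnesBelow (2 * m) = 2 * binaryOnesBelow m + m := by
  induction m with
  | zero => rfl
  | succ m ih =>
    rw [show 2 * (m + 1) = 2 * m + 1 + 1 by ring, binaryOnesBelow_succ, binaryOnesBelow_succ,
      binaryOnesBelow_succ, ih, digits_two_sum_two_mul, digits_two_sum_two_mul_add_one]
    ring

theorem binaryOnesBelow_two_mul_add_one (m : ℕ) :
    binaryOnesBelow (2 * m + 1) = binaryOnesBelow m + binaryOnesBelow (m + 1) + m := by
  rw [binaryOnesBelow_succ, binaryOnesBelow_succ, binaryOnesBelow_two_mul,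
    digits_two_sum_two_mul]
  ring

theorem binaryOnesBelow_add_add_min_le (a b : ℕ) :
    binaryOnesBelow a + binaryOnesBelow b + min a b ≤ binaryOnesBelow (a + b) := by
  induction hk : a + b using Nat.strong_induction_on generalizing a b with
  | _ k ih =>
  subst hk
  rcases Nat.eq_zero_or_pos a with rfl | ha
  · simp
  rcases Nat.eq_zero_or_pos b with rfl | hb
  · simp
  obtain ⟨c, rfl | rfl⟩ := Nat.even_or_odd' a <;> obtain ⟨d, rfl | rfl⟩ := Nat.even_or_odd' b
  · have h := ih (c + d) (by omega) c d rfl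
    rw [← mul_add]
    simp only [binaryOnesBelow_two_mul]
    omega
  · have h₁ := ih (c + d) (by omega) c d rfl
    have h₂ := ih (c + d + 1) (by omega) c (d + 1) (by ring)
    rw [show 2 * c + (2 * d + 1) = 2 * (c + d) + 1 by ring]
    simp only [binaryOnesBelow_two_mul, binaryOnesBelow_two_mul_add_one]
    omega
  · have h₁ := ih (c + d) (by omega) c d rfl
    have h₂ := ih (c + d + 1) (by omega) (c + 1) d (by ring)
    rw [show 2 * c + 1 + 2 * d = 2 * (c + d) + 1 by ring]
    simp only [binaryOnesBelow_two_mul, binaryOnesBelow_two_mul_add_one]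
    omega
  · have h₁ := ih (c + d + 1) (by omega) c (d + 1) (by ring)
    have h₂ := ih (c + d + 1) (by omega) (c + 1) d (by ring)
    rw [show 2 * c + 1 + (2 * d + 1) = 2 * (c + d + 1) by ring]
    simp only [binaryOnesBelow_two_mul, binaryOnesBelow_two_mul_add_one]
    omega

theorem binaryOnesBelow_two_pow_add (t r : ℕ) (hr : r ≤ 2 ^ t) :
    binaryOnesBelow (2 ^ t + r) = binaryOnesBelow (2 ^ t) + binaryOnesBelow r + r := by
  induction t generalizing r with
  | zero =>
    have h := binaryOnesBelow_two_mul 1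
    obtain rfl | rfl : r = 0 ∨ r = 1 := by simp at hr; omega
    · simp
    · simpa using h
  | succ t ih =>
    rw [pow_succ'] at hr ⊢
    obtain ⟨c, rfl | rfl⟩ := Nat.even_or_odd' r
    · have h := ih c (by omega)
      rw [← mul_add]
      simp only [binaryOnesBelow_two_mul]
      omega
    · have h₁ := ih c (by omega)
      have h₂ := ih (c + 1) (by omega)
      rw [← add_assoc] at h₂
      rw [← add_assoc, ← mul_add]
      simp only [binaryOnesBelow_two_mul, binaryOnesBelow_two_mul_add_one]
      omega

theorem two_mul_binaryOnesBelow_two_pow (t : ℕ) :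
    2 * binaryOnesBelow (2 ^ t) = t * 2 ^ t := by
  induction t with
  | zero => simp
  | succ t ih =>
    rw [pow_succ', binaryOnesBelow_two_mul, mul_add, mul_left_comm, ih]
    ring

theorem sum_two_pow_lt_of_strictAnti (s : ℕ) (t : Fin (s + 1) → ℕ) (ht : StrictAnti t) :
    ∑ i, 2 ^ t i < 2 ^ (t 0 + 1) := by
  induction s with
  | zero => simp [pow_succ]
  | succ s ih =>
    have h := ih (fun i => t i.succ) (fun i j hij => ht (Fin.succ_lt_succ_iff.2 hij))
    have h01 : t (Fin.succ 0) + 1 ≤ t 0 := ht (Fin.succ_pos 0)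
    have hle := Nat.pow_le_pow_right (n := 2) (by norm_num) h01
    rw [Fin.sum_univ_succ, pow_succ]
    omega

theorem two_mul_binaryOnesBelow_sum_two_pow (s : ℕ) (t : Fin (s + 1) → ℕ) (ht : StrictAnti t) :
    2 * binaryOnesBelow (∑ i, 2 ^ t i) = ∑ i : Fin (s + 1), (t i + 2 * (i : ℕ)) * 2 ^ t i := by
  induction s with
  | zero => simp [two_mul_binaryOnesBelow_two_pow]
  | succ s ih =>
    have hanti : StrictAnti fun i : Fin (s + 1) => t i.succ :=
      fun i j hij => ht (Fin.succ_lt_succ_iff.2 hij)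
    have h := ih _ hanti
    have hlt := sum_two_pow_lt_of_strictAnti s _ hanti
    have h01 : t (Fin.succ 0) + 1 ≤ t 0 := ht (Fin.succ_pos 0)
    have hle := Nat.pow_le_pow_right (n := 2) (by norm_num) h01
    rw [Fin.sum_univ_succ, binaryOnesBelow_two_pow_add _ _ (hlt.le.trans hle), mul_add, mul_add,
      h, two_mul_binaryOnesBelow_two_pow, Fin.sum_univ_succ (n := s + 1), add_assoc, Finset.mul_sum,
      ← Finset.sum_add_distrib]
    congr 1
    refine Finset.sum_congr rfl fun i _ => ?_
    rw [Fin.val_succ]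
    ring

open Classical in
/-- The number of ordered pairs of adjacent vertices with first entry in `X` and second entry
in `Y`. -/
noncomputable def adjPairs {V : Type} (G : SimpleGraph V) (X Y : Finset V) : ℕ :=
  ∑ v ∈ X, ∑ w ∈ Y, if G.Adj v w then 1 else 0

theorem adjPairs_comm {V : Type} (G : SimpleGraph V) (X Y : Finset V) :
    adjPairs G X Y = adjPairs G Y X := by
  unfold adjPairs
  rw [Finset.sum_comm]
  refine Finset.sum_congr rfl fun v _ => Finset.sum_congr rfl fun w _ => ?_
  rw [G.adj_comm]

theorem adjPairs_union_self {V : Type} [DecidableEq V] (G : SimpleGraph V) {A B : Finset V}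
    (h : Disjoint A B) :
    adjPairs G (A ∪ B) (A ∪ B) = adjPairs G A A + adjPairs G B B + 2 * adjPairs G A B := by
  have hBA := adjPairs_comm G B A
  unfold adjPairs at *
  simp only [Finset.sum_union h, Finset.sum_add_distrib]
  omega

theorem adjPairs_map_subtype {V : Type} (G : SimpleGraph V) (s : Set V) (X Y : Finset s) :
    adjPairs G (X.map (Function.Embedding.subtype _)) (Y.map (Function.Embedding.subtype _)) =
      adjPairs (G.induce s) X Y := by
  simp only [adjPairs, Finset.sum_map, Function.Embedding.subtype_apply]
  rfl

theorem adjPairs_le_card {V : Type} (G : SimpleGraph V) (A B : Finset V)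
    (h : ∀ v ∈ A, ∀ w ∈ B, ∀ w' ∈ B, G.Adj v w → G.Adj v w' → w = w') :
    adjPairs G A B ≤ A.card := by
  classical
  rw [Finset.card_eq_sum_ones]
  refine Finset.sum_le_sum fun v hv => ?_
  rw [← Finset.card_filter, Finset.card_le_one]
  intro w hw w' hw'
  rw [Finset.mem_filter] at hw hw'
  exact h v hv w hw.1 w' hw'.1 hw.2 hw'.2

theorem card_le_adjPairs {V : Type} (G : SimpleGraph V) (A B : Finset V)
    (h : ∀ v ∈ A, ∃ w ∈ B, G.Adj v w) : A.card ≤ adjPairs G A B := by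
  classical
  rw [Finset.card_eq_sum_ones]
  refine Finset.sum_le_sum fun v hv => ?_
  obtain ⟨w, hw, hvw⟩ := h v hv
  rw [← Finset.card_filter, Nat.one_le_iff_ne_zero, Finset.card_ne_zero]
  exact ⟨w, Finset.mem_filter.2 ⟨hw, hvw⟩⟩

theorem two_mul_ncard_edgeSet_induce {V : Type} (G : SimpleGraph V) (X : Finset V) :
    2 * (G.induce (X : Set V)).edgeSet.ncard = adjPairs G X X := by
  classical
  rw [← SimpleGraph.coe_edgeFinset, Set.ncard_coe_finset,
    ← SimpleGraph.sum_degrees_eq_twice_card_edges]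
  have hmap : X = (Finset.univ : Finset (X : Set V)).map (Function.Embedding.subtype _) := by
    ext v
    simp
  conv_rhs => rw [hmap]
  rw [adjPairs_map_subtype]
  refine Finset.sum_congr rfl fun v _ => ?_
  rw [← SimpleGraph.card_neighborFinset_eq_degree, SimpleGraph.neighborFinset_eq_filter,
    Finset.card_filter]
  simp only [SimpleGraph.comap_adj]

theorem IsHL.card_eq {n : ℕ} {V : Type} [Fintype V] [DecidableEq V] {G : SimpleGraph V}
    (hG : IsHL n G) : Fintype.card V = 2 ^ n := by
  induction n generalizing V with
  | zero => simpa [IsHL] using hG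
  | succ n ih =>
    obtain ⟨S, h₁, h₂, -, -⟩ := hG
    have c₁ := ih h₁
    have c₂ := ih h₂
    simp only [Finset.coe_sort_coe, Fintype.card_coe] at c₁ c₂
    rw [← Finset.card_add_card_compl S, c₁, c₂]
    ring

theorem IsHL.adjPairs_le {n : ℕ} {V : Type} [Fintype V] [DecidableEq V] {G : SimpleGraph V}
    (hG : IsHL n G) (X : Finset V) : adjPairs G X X ≤ 2 * binaryOnesBelow X.card := by
  induction n generalizing V with
  | zero =>
    have hsub : Subsingleton V := Fintype.card_le_one_iff_subsingleton.1 (le_of_eq hG)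
    simp [adjPairs, Subsingleton.elim _ (⊥ : SimpleGraph V)]
  | succ n ih =>
    obtain ⟨S, h₁, h₂, hm₁, hm₂⟩ := hG
    have hpart : ∀ T : Finset V, IsHL n (G.induce (T : Set V)) →
        adjPairs G (X ∩ T) (X ∩ T) ≤ 2 * binaryOnesBelow (X ∩ T).card := by
      intro T hT
      have hmap : X ∩ T =
          (X.subtype (· ∈ (T : Set V))).map (Function.Embedding.subtype _) := by
        ext v
        simp
      have h := ih hT (X.subtype (· ∈ (T : Set V)))
      rwa [← adjPairs_map_subtype, ← Finset.card_map (Function.Embedding.subtype _), ← hmap] at h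
    have hdisj : Disjoint (X ∩ S) (X ∩ Sᶜ) :=
      disjoint_compl_right.mono Finset.inter_subset_right Finset.inter_subset_right
    have hunion : X ∩ S ∪ X ∩ Sᶜ = X := by
      rw [← Finset.inter_union_distrib_left, Finset.union_compl, Finset.inter_univ]
    have hcard : (X ∩ S).card + (X ∩ Sᶜ).card = X.card := by
      rw [← Finset.card_union_of_disjoint hdisj, hunion]
    have hA : adjPairs G (X ∩ S) (X ∩ Sᶜ) ≤ (X ∩ S).card := by
      refine adjPairs_le_card G _ _ fun v hv w hw w' hw' a a' => ?_
      simp only [Finset.mem_inter, Finset.mem_compl] at hv hw hw'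
      exact (hm₁ v hv.2).unique ⟨hw.2, a⟩ ⟨hw'.2, a'⟩
    have hB : adjPairs G (X ∩ S) (X ∩ Sᶜ) ≤ (X ∩ Sᶜ).card := by
      rw [adjPairs_comm]
      refine adjPairs_le_card G _ _ fun v hv w hw w' hw' a a' => ?_
      simp only [Finset.mem_inter, Finset.mem_compl] at hv hw hw'
      exact (hm₂ v hv.2).unique ⟨hw.2, a⟩ ⟨hw'.2, a'⟩
    have hsplit := adjPairs_union_self G hdisj
    rw [hunion] at hsplit
    have hmin := binaryOnesBelow_add_add_min_le (X ∩ S).card (X ∩ Sᶜ).card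
    rw [hcard] at hmin
    have hpS := hpart S h₁
    have hpC := hpart Sᶜ h₂
    omega

theorem IsHL.exists_le_adjPairs {n : ℕ} {V : Type} [Fintype V] [DecidableEq V]
    {G : SimpleGraph V} (hG : IsHL n G) {g : ℕ} (hg : g ≤ 2 ^ n) :
    ∃ X : Finset V, X.card = g ∧ 2 * binaryOnesBelow g ≤ adjPairs G X X := by
  induction n generalizing V g with
  | zero =>
    obtain ⟨X, -, hX⟩ := Finset.exists_subset_card_eq
      (s := (Finset.univ : Finset V)) (hg.trans_eq hG.card_eq.symm)
    refine ⟨X, hX, ?_⟩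
    obtain rfl | rfl : g = 0 ∨ g = 1 := by rw [pow_zero] at hg; omega
    all_goals simp
  | succ n ih =>
    obtain ⟨S, h₁, h₂, hm₁, hm₂⟩ := hG
    have hpart : ∀ T : Finset V, IsHL n (G.induce (T : Set V)) → ∀ r ≤ 2 ^ n,
        ∃ Y ⊆ T, Y.card = r ∧ 2 * binaryOnesBelow r ≤ adjPairs G Y Y := by
      intro T hT r hr
      obtain ⟨Y, hY, hle⟩ := ih hT hr
      refine ⟨Y.map (Function.Embedding.subtype _), ?_, by rw [Finset.card_map, hY], ?_⟩
      · intro v hv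
        obtain ⟨w, -, rfl⟩ := Finset.mem_map.1 hv
        exact w.2
      · rwa [adjPairs_map_subtype]
    rcases le_total g (2 ^ n) with h | h
    · obtain ⟨Y, -, hY⟩ := hpart S h₁ g h
      exact ⟨Y, hY⟩
    · obtain ⟨r, rfl⟩ := Nat.exists_eq_add_of_le h
      have hr : r ≤ 2 ^ n := by rw [pow_succ] at hg; omega
      obtain ⟨A, hAS, hA, hA'⟩ := hpart S h₁ _ le_rfl
      obtain ⟨B, hBS, hB, hB'⟩ := hpart Sᶜ h₂ r hr
      have hSc := h₁.card_eq
      simp only [Finset.coe_sort_coe, Fintype.card_coe] at hSc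
      obtain rfl : A = S := Finset.eq_of_subset_of_card_le hAS (by omega)
      have hdisj : Disjoint A B := disjoint_compl_right.mono_right hBS
      refine ⟨A ∪ B, by rw [Finset.card_union_of_disjoint hdisj, hA, hB], ?_⟩
      have hcross : B.card ≤ adjPairs G B A := by
        refine card_le_adjPairs G _ _ fun v hv => ?_
        obtain ⟨w, hw, -⟩ := hm₂ v (Finset.mem_compl.1 (hBS hv))
        exact ⟨w, hw⟩
      rw [adjPairs_comm] at hcross
      rw [adjPairs_union_self G hdisj, binaryOnesBelow_two_pow_add _ _ hr]
      omega

/-- Lemma 2.1: for `G ∈ HL_n` and `1 ≤ g ≤ 2^n` with binary expansion `g = ∑_{i=0}^s 2^(t i)`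
(`t 0 > t 1 > ... > t s ≥ 0`), the maximum over all vertex sets `X` with `|X| = g` of the
number of edges of the induced subgraph `G[X]` equals
`e_g = ∑ t i * 2^(t i - 1) + ∑ i * 2^(t i)`; equivalently, twice this maximum equals
`∑_{i=0}^s (t i + 2 i) * 2^(t i)`. -/
theorem max_induced_edges_HL
    {n : ℕ} (hn : 1 ≤ n) {V : Type} [Fintype V] [DecidableEq V]
    (G : SimpleGraph V) (hG : IsHL n G)
    (g : ℕ) (hg1 : 1 ≤ g) (hg2 : g ≤ 2 ^ n)
    (s : ℕ) (t : Fin (s + 1) → ℕ) (ht : StrictAnti t)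
    (hsum : g = ∑ i, 2 ^ (t i)) :
    (∀ X : Finset V, X.card = g →
        2 * (G.induce (X : Set V)).edgeSet.ncard ≤ ∑ i : Fin (s + 1), (t i + 2 * (i : ℕ)) * 2 ^ (t i)) ∧
      (∃ X : Finset V, X.card = g ∧
        2 * (G.induce (X : Set V)).edgeSet.ncard = ∑ i : Fin (s + 1), (t i + 2 * (i : ℕ)) * 2 ^ (t i)) := by
  subst hsum
  rw [← two_mul_binaryOnesBelow_sum_two_pow s t ht]
  constructor
  · intro X hX
    rw [two_mul_ncard_edgeSet_induce, ← hX]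
    exact hG.adjPairs_le X
  · obtain ⟨X, hX, hle⟩ := hG.exists_le_adjPairs hg2
    refine ⟨X, hX, ?_⟩
    rw [two_mul_ncard_edgeSet_induce]
    exact le_antisymm (hX ▸ hG.adjPairs_le X) hle
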